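/- The alternating bilinear maps φ_1 and φ_2 are 2-cocycles of g_{−1} with coefficients in the adjoint module, and for ε_1, ε_2 ∈ ℝ the deformed bracket (X,Y) ↦ μ_{−1}(X,Y) + ε_1 φ_1(X,Y) + ε_2 φ_2(X,Y) on ℝ^8 satisfies the Jacobi identity if and only if ε_1 ε_2 = 0. -/

import Mathlib

/-- The underlying space `ℝ⁸` of the family `g_α`. -/
abbrev V8 : Type := Fin 8 → ℝ

/-- The standard basis vector `X_{k+1}` (0-indexed: `e8 k`). -/
def e8 (k : Fin 8) : V8 := fun l => if l = k then 1 else 0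

/-- Brackets of basis elements of `g_α` for `i < j` (0-indexed, `X_{i+1} = e8 i`):
`u α i j = [X_{i+1}, X_{j+1}]`. -/
noncomputable def gUpper (α : ℝ) : Fin 8 → Fin 8 → V8 := fun i j =>
  match (i : ℕ), (j : ℕ) with
  | 0, 1 => (2 : ℝ) • e8 1          -- [X₁,X₂] = 2X₂
  | 0, 2 => (-2 : ℝ) • e8 2         -- [X₁,X₃] = −2X₃
  | 1, 2 => e8 0                    -- [X₂,X₃] = X₁
  | 0, 3 => e8 3                    -- [X₁,X₄] = X₄
  | 0, 4 => -e8 4                   -- [X₁,X₅] = −X₅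
  | 0, 5 => e8 5                    -- [X₁,X₆] = X₆
  | 0, 6 => -e8 6                   -- [X₁,X₇] = −X₇
  | 1, 4 => e8 3                    -- [X₂,X₅] = X₄
  | 1, 6 => e8 5                    -- [X₂,X₇] = X₆
  | 2, 3 => e8 4                    -- [X₃,X₄] = X₅
  | 2, 5 => e8 6                    -- [X₃,X₆] = X₇
  | 3, 7 => e8 3                    -- [X₄,X₈] = X₄
  | 4, 7 => e8 4                    -- [X₅,X₈] = X₅
  | 5, 7 => α • e8 5                -- [X₆,X₈] = αX₆
  | 6, 7 => α • e8 6                -- [X₇,X₈] = αX₇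
  | _, _ => 0

/-- The structure constants `C_{ij}^k` of `g_α`. -/
noncomputable def gC (α : ℝ) (i j k : Fin 8) : ℝ := gUpper α i j k - gUpper α j i k

/-- The bilinear map on `ℝ⁸` with structure constants `C`. -/
noncomputable def brOf (C : Fin 8 → Fin 8 → Fin 8 → ℝ) : V8 →ₗ[ℝ] V8 →ₗ[ℝ] V8 :=
  LinearMap.mk₂ ℝ (fun x y k => ∑ i, ∑ j, C i j k * x i * y j)
    (by
      intro x x' y
      funext k
      simp only [Pi.add_apply]
      rw [← Finset.sum_add_distrib]
      refine Finset.sum_congr rfl fun i _ => ?_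
      rw [← Finset.sum_add_distrib]
      exact Finset.sum_congr rfl fun j _ => by ring)
    (by
      intro c x y
      funext k
      simp only [Pi.smul_apply, smul_eq_mul]
      rw [Finset.mul_sum]
      refine Finset.sum_congr rfl fun i _ => ?_
      rw [Finset.mul_sum]
      exact Finset.sum_congr rfl fun j _ => by ring)
    (by
      intro x y y'
      funext k
      simp only [Pi.add_apply]
      rw [← Finset.sum_add_distrib]
      refine Finset.sum_congr rfl fun i _ => ?_
      rw [← Finset.sum_add_distrib]
      exact Finset.sum_congr rfl fun j _ => by ring)
    (by
      intro c x y
      funext k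
      simp only [Pi.smul_apply, smul_eq_mul]
      rw [Finset.mul_sum]
      refine Finset.sum_congr rfl fun i _ => ?_
      rw [Finset.mul_sum]
      exact Finset.sum_congr rfl fun j _ => by ring)

/-- The Lie bracket `μ_α` of the Lie algebra `g_α`, as a bilinear map on `ℝ⁸`. -/
noncomputable def brA (α : ℝ) : V8 →ₗ[ℝ] V8 →ₗ[ℝ] V8 := brOf (gC α)

/-- Values `φ₁(X_{i+1}, X_{j+1})` for `i < j` (0-indexed). -/
noncomputable def phi1Upper : Fin 8 → Fin 8 → V8 := fun i j =>
  match (i : ℕ), (j : ℕ) with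
  | 3, 5 => e8 1                                        -- φ₁(X₄,X₆) = X₂
  | 3, 6 => (-(1:ℝ)/2) • e8 0 + ((3:ℝ)/2) • e8 7        -- φ₁(X₄,X₇) = −½X₁+³⁄₂X₈
  | 4, 5 => (-(1:ℝ)/2) • e8 0 - ((3:ℝ)/2) • e8 7        -- φ₁(X₅,X₆) = −½X₁−³⁄₂X₈
  | 4, 6 => -e8 2                                       -- φ₁(X₅,X₇) = −X₃
  | _, _ => 0

/-- The alternating bilinear map `φ₁` on `ℝ⁸`. -/
noncomputable def phi1 : V8 →ₗ[ℝ] V8 →ₗ[ℝ] V8 :=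
  brOf (fun i j k => phi1Upper i j k - phi1Upper j i k)

/-- Values `φ₂(X_{i+1}, X_{j+1})` for `i < j` (0-indexed). -/
noncomputable def phi2Upper : Fin 8 → Fin 8 → V8 := fun i j =>
  match (i : ℕ), (j : ℕ) with
  | 5, 7 => e8 5                                        -- φ₂(X₆,X₈) = X₆
  | 6, 7 => e8 6                                        -- φ₂(X₇,X₈) = X₇
  | _, _ => 0

/-- The alternating bilinear map `φ₂` on `ℝ⁸`. -/
noncomputable def phi2 : V8 →ₗ[ℝ] V8 →ₗ[ℝ] V8 :=
  brOf (fun i j k => phi2Upper i j k - phi2Upper j i k)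

/-- A bilinear map satisfies the Jacobi identity. -/
def JacobiBil (B : V8 →ₗ[ℝ] V8 →ₗ[ℝ] V8) : Prop :=
  ∀ x y z : V8, B x (B y z) + B y (B z x) + B z (B x y) = 0

/-- `ψ` is a 2-cocycle of the Lie algebra with bracket `B`, with adjoint coefficients. -/
def IsCocycle2 (B ψ : V8 →ₗ[ℝ] V8 →ₗ[ℝ] V8) : Prop :=
  ∀ X Y Z : V8,
    B X (ψ Y Z) + B Z (ψ X Y) + B Y (ψ Z X)
      + ψ X (B Y Z) + ψ Z (B X Y) + ψ Y (B Z X) = 0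

set_option maxHeartbeats 1000000 in
-- Each of the eight components expands to a sum of 64 terms.
theorem brA_apply (α : ℝ) (x y : V8) :
    brA α x y =
      ![x 1 * y 2 - x 2 * y 1,
        2 * (x 0 * y 1 - x 1 * y 0),
        -2 * (x 0 * y 2 - x 2 * y 0),
        (x 0 * y 3 - x 3 * y 0) + (x 1 * y 4 - x 4 * y 1) + (x 3 * y 7 - x 7 * y 3),
        -(x 0 * y 4 - x 4 * y 0) + (x 2 * y 3 - x 3 * y 2) + (x 4 * y 7 - x 7 * y 4),
        (x 0 * y 5 - x 5 * y 0) + (x 1 * y 6 - x 6 * y 1) + α * (x 5 * y 7 - x 7 * y 5),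
        -(x 0 * y 6 - x 6 * y 0) + (x 2 * y 5 - x 5 * y 2) + α * (x 6 * y 7 - x 7 * y 6),
        0] := by
  funext k
  simp only [brA, brOf, LinearMap.mk₂_apply, gC, Fin.sum_univ_eight]
  fin_cases k <;> simp [gUpper, e8] <;> ring

theorem phi1_apply (x y : V8) :
    phi1 x y =
      ![-(1 / 2) * ((x 3 * y 6 - x 6 * y 3) + (x 4 * y 5 - x 5 * y 4)),
        x 3 * y 5 - x 5 * y 3,
        -(x 4 * y 6 - x 6 * y 4),
        0, 0, 0, 0,
        3 / 2 * ((x 3 * y 6 - x 6 * y 3) - (x 4 * y 5 - x 5 * y 4))] := by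
  funext k
  simp only [phi1, brOf, LinearMap.mk₂_apply, Fin.sum_univ_eight]
  fin_cases k <;> simp [phi1Upper, e8] <;> ring

theorem phi2_apply (x y : V8) :
    phi2 x y = ![0, 0, 0, 0, 0, x 5 * y 7 - x 7 * y 5, x 6 * y 7 - x 7 * y 6, 0] := by
  funext k
  simp only [phi2, brOf, LinearMap.mk₂_apply, Fin.sum_univ_eight]
  fin_cases k <;> simp [phi2Upper, e8] <;> ring

theorem isCocycle2_phi1 : IsCocycle2 (brA (-1)) phi1 := by
  intro x y z
  funext k
  fin_cases k <;> simp [brA_apply, phi1_apply] <;> ring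

theorem isCocycle2_phi2 : IsCocycle2 (brA (-1)) phi2 := by
  intro x y z
  funext k
  fin_cases k <;> simp [brA_apply, phi2_apply] <;> ring

theorem jacobiBil_brA_add_smul_phi1 (ε : ℝ) : JacobiBil (brA (-1) + ε • phi1) := by
  intro x y z
  funext k
  fin_cases k <;> simp [brA_apply, phi1_apply] <;> ring

theorem jacobiBil_brA_add_smul_phi2 (ε : ℝ) : JacobiBil (brA (-1) + ε • phi2) := by
  intro x y z
  funext k
  fin_cases k <;> simp [brA_apply, phi2_apply] <;> ring

/-- The second component of the Jacobi identity on `X₄, X₆, X₈` is `ε₁ε₂`. -/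
theorem mul_eq_zero_of_jacobiBil {ε₁ ε₂ : ℝ}
    (h : JacobiBil (brA (-1) + ε₁ • phi1 + ε₂ • phi2)) : ε₁ * ε₂ = 0 := by
  have h₁ := congrFun (h (e8 3) (e8 5) (e8 7)) 1
  simp [brA_apply, phi1_apply, phi2_apply, e8] at h₁
  linear_combination h₁

/-- `φ₁` and `φ₂` are 2-cocycles of `g_{−1}` with adjoint coefficients, and the deformed
bracket `μ_{−1} + ε₁φ₁ + ε₂φ₂` satisfies the Jacobi identity iff `ε₁ε₂ = 0`. -/
theorem phi_cocycles_and_jacobi_obstruction :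
    IsCocycle2 (brA (-1)) phi1 ∧ IsCocycle2 (brA (-1)) phi2 ∧
    ∀ ε₁ ε₂ : ℝ, JacobiBil (brA (-1) + ε₁ • phi1 + ε₂ • phi2) ↔ ε₁ * ε₂ = 0 := by
  refine ⟨isCocycle2_phi1, isCocycle2_phi2, fun ε₁ ε₂ => ⟨mul_eq_zero_of_jacobiBil, fun h => ?_⟩⟩
  rcases mul_eq_zero.mp h with rfl | rfl
  · simpa using jacobiBil_brA_add_smul_phi2 ε₂
  · simpa using jacobiBil_brA_add_smul_phi1 ε₁
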